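/- arXiv:0906.3804 — 2 statements merged into one kernel-verified Lean document; each statement's English description precedes it below -/
import Mathlib

section
/- Let 0 < κ < 4, set a = 2/κ, and let β > 0. Then there exists a constant c < ∞ such that for every z ∈ ℍ, Φ*(z) := ∫_{w ∈ ℍ, Im w < 2a} (Im w)^{8/κ − 2} · |w|^{2 − 8/κ} · |z − w|^{−κ/4} · |z − conj(w)|^{−κ/4} · e^{−β (Re w)²} dA(w) ≤ c · |z|^{−κ/2}. -/
open MeasureTheory

/-- Powers of the norm above `-2` are integrable on `ℂ` against `exp (-b * ‖x‖ ^ p)`. -/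
lemma Complex.integrable_rpow_mul_exp_neg_mul_rpow {p q b : ℝ} (hp : 1 ≤ p) (hq : -2 < q)
    (hb : 0 < b) :
    Integrable (fun x : ℂ => ‖x‖ ^ q * Real.exp (-b * ‖x‖ ^ p)) := by
  refine not_imp_comm.1 integral_undef ?_
  rw [Complex.integral_rpow_mul_exp_neg_mul_rpow hp hq hb]
  have : 0 < Real.Gamma ((q + 2) / p) := Real.Gamma_pos_of_pos (by apply div_pos <;> linarith)
  positivity

/-- In the upper half-plane, `‖z - w‖ ≤ ‖z - conj w‖`. -/
lemma Complex.norm_sub_le_norm_sub_conj {z w : ℂ} (hz : 0 ≤ z.im) (hw : 0 ≤ w.im) :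
    ‖z - w‖ ≤ ‖z - (starRingEnd ℂ) w‖ := by
  rw [← sq_le_sq₀ (norm_nonneg _) (norm_nonneg _), Complex.sq_norm, Complex.sq_norm,
    Complex.normSq_apply, Complex.normSq_apply]
  simp only [Complex.sub_re, Complex.sub_im, Complex.conj_re, Complex.conj_im]
  nlinarith [mul_nonneg hz hw]

/-- Splitting a negative power of a sum, with the weight moved to the other side. -/
lemma Real.rpow_add_mul_rpow_neg_le {x y p : ℝ} (hx : 0 < x) (hy : 0 ≤ y) (hp : 0 ≤ p) :
    (x + y) ^ p * x ^ (-p) ≤ 2 ^ p * (1 + y ^ p * x ^ (-p)) := by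
  have hmax : (x + y) ^ p ≤ 2 ^ p * (x ^ p + y ^ p) := by
    rcases le_total x y with h | h
    · calc (x + y) ^ p ≤ (2 * y) ^ p := Real.rpow_le_rpow (by linarith) (by linarith) hp
        _ = 2 ^ p * y ^ p := Real.mul_rpow (by norm_num) hy
        _ ≤ _ := by gcongr; linarith [Real.rpow_nonneg hx.le p]
    · calc (x + y) ^ p ≤ (2 * x) ^ p := Real.rpow_le_rpow (by linarith) (by linarith) hp
        _ = 2 ^ p * x ^ p := Real.mul_rpow (by norm_num) hx.le
        _ ≤ _ := by gcongr; linarith [Real.rpow_nonneg hy p]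
  have hinv : x ^ p * x ^ (-p) = 1 := by
    rw [← Real.rpow_add hx, add_neg_cancel, Real.rpow_zero]
  calc (x + y) ^ p * x ^ (-p) ≤ 2 ^ p * (x ^ p + y ^ p) * x ^ (-p) := by gcongr
    _ = 2 ^ p * (x ^ p * x ^ (-p) + y ^ p * x ^ (-p)) := by ring
    _ = _ := by rw [hinv]

/-- A power below the square is absorbed by a Gaussian of smaller variance. -/
lemma Real.rpow_mul_exp_neg_sq_le {y p b : ℝ} (hy : 0 ≤ y) (hp : 0 ≤ p) (hp2 : p ≤ 2)
    (hb : 0 < b) :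
    y ^ p * Real.exp (-(2 * b) * y ^ 2) ≤ (1 + 1 / b) * Real.exp (-b * y ^ 2) := by
  have hpow : y ^ p ≤ 1 + y ^ 2 := by
    rcases le_total y 1 with h | h
    · linarith [Real.rpow_le_one hy h hp, sq_nonneg y]
    · have := Real.rpow_le_rpow_of_exponent_le h hp2
      rw [Real.rpow_two] at this
      linarith
  have hexp : 1 + y ^ 2 ≤ (1 + 1 / b) * Real.exp (b * y ^ 2) := by
    have h1 := Real.add_one_le_exp (b * y ^ 2)
    have h2 : 0 ≤ b * y ^ 2 := by positivity
    have h3 : y ^ 2 = 1 / b * (b * y ^ 2) := by field_simp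
    have h4 : 1 / b * (b * y ^ 2) ≤ 1 / b * Real.exp (b * y ^ 2) := by gcongr; linarith
    linarith
  calc y ^ p * Real.exp (-(2 * b) * y ^ 2)
      ≤ (1 + 1 / b) * Real.exp (b * y ^ 2) * Real.exp (-(2 * b) * y ^ 2) := by
        gcongr; exact hpow.trans hexp
    _ = _ := by rw [mul_assoc, ← Real.exp_add]; ring_nf

/-- A negative power is bounded by `1` plus an exponentially damped copy of itself. -/
lemma Real.rpow_neg_le_one_add_exp {x p : ℝ} (hx : 0 < x) (hp : 0 ≤ p) :
    x ^ (-p) ≤ 1 + Real.exp 1 * (x ^ (-p) * Real.exp (-x)) := by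
  have h0 := Real.rpow_nonneg hx.le (-p)
  rcases le_total 1 x with h | h
  · have := Real.rpow_le_one_of_one_le_of_nonpos h (neg_nonpos.2 hp)
    have : 0 ≤ Real.exp 1 * (x ^ (-p) * Real.exp (-x)) := by positivity
    linarith
  · have h1 : 1 ≤ Real.exp 1 * Real.exp (-x) := by
      rw [← Real.exp_add]; exact Real.one_le_exp (by linarith)
    nlinarith

/-- The weighted Riesz kernel on a horizontal strip, dominated by `‖z‖ ^ (-p)` times integrable
functions of `w` and of `z - w`. -/
lemma norm_sub_rpow_neg_mul_exp_le {z w : ℂ} {p b h : ℝ} (hz : z ≠ 0) (hzw : z ≠ w)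
    (hp : 0 ≤ p) (hp2 : p ≤ 2) (hb : 0 < b) (hw : 0 ≤ w.im) (hwh : w.im ≤ h) :
    ‖z - w‖ ^ (-p) * Real.exp (-(2 * b) * w.re ^ 2) ≤
      2 ^ p * Real.exp (2 * b * h ^ 2) *
        ((2 + 1 / b) * Real.exp (-b * ‖w‖ ^ 2) +
          (1 + 1 / b) * Real.exp 1 * (‖z - w‖ ^ (-p) * Real.exp (-‖z - w‖))) * ‖z‖ ^ (-p) := by
  have hx : 0 < ‖z - w‖ := norm_pos_iff.2 (sub_ne_zero.2 hzw)
  have hz0 : 0 < ‖z‖ := norm_pos_iff.2 hz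
  have hzp : ‖z‖ ^ p * ‖z‖ ^ (-p) = 1 := by
    rw [← Real.rpow_add hz0, add_neg_cancel, Real.rpow_zero]
  have htri : ‖z‖ ≤ ‖z - w‖ + ‖w‖ := by simpa using norm_add_le (z - w) w
  have hsplit : ‖z‖ ^ p * ‖z - w‖ ^ (-p) ≤ 2 ^ p * (1 + ‖w‖ ^ p * ‖z - w‖ ^ (-p)) :=
    le_trans (by gcongr) (Real.rpow_add_mul_rpow_neg_le hx (norm_nonneg w) hp)
  have hre : Real.exp (-(2 * b) * w.re ^ 2) ≤
      Real.exp (2 * b * h ^ 2) * Real.exp (-(2 * b) * ‖w‖ ^ 2) := by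
    rw [← Real.exp_add, Complex.sq_norm, Complex.normSq_apply]
    gcongr
    have : w.im ^ 2 ≤ h ^ 2 := by gcongr
    nlinarith
  have hgauss := Real.rpow_mul_exp_neg_sq_le (norm_nonneg w) hp hp2 hb
  have hgauss0 : Real.exp (-(2 * b) * ‖w‖ ^ 2) ≤ Real.exp (-b * ‖w‖ ^ 2) := by
    gcongr
    nlinarith
  have hdamp := Real.rpow_neg_le_one_add_exp hx hp
  have hone : Real.exp (-b * ‖w‖ ^ 2) ≤ 1 :=
    Real.exp_le_one_iff.2 (by nlinarith [sq_nonneg ‖w‖])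
  set u := ‖z - w‖ ^ (-p)
  set v := Real.exp (-b * ‖w‖ ^ 2)
  set G := Real.exp (-(2 * b) * ‖w‖ ^ 2)
  set d := Real.exp (-‖z - w‖)
  have hu : 0 ≤ u := Real.rpow_nonneg hx.le _
  have hv : 0 ≤ v := Real.exp_nonneg _
  have hd : 0 ≤ Real.exp 1 * (u * d) := by positivity
  have hvu : v * u ≤ v + Real.exp 1 * (u * d) :=
    calc v * u ≤ v * (1 + Real.exp 1 * (u * d)) := by gcongr
      _ = v + v * (Real.exp 1 * (u * d)) := by ring
      _ ≤ v + 1 * (Real.exp 1 * (u * d)) := by gcongr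
      _ = _ := by ring
  have hmain : (1 + ‖w‖ ^ p * u) * G ≤ (2 + 1 / b) * v + (1 + 1 / b) * Real.exp 1 * (u * d) :=
    calc (1 + ‖w‖ ^ p * u) * G = G + (‖w‖ ^ p * G) * u := by ring
      _ ≤ v + ((1 + 1 / b) * v) * u := by gcongr
      _ = v + (1 + 1 / b) * (v * u) := by ring
      _ ≤ v + (1 + 1 / b) * (v + Real.exp 1 * (u * d)) := by gcongr
      _ = _ := by ring
  calc u * Real.exp (-(2 * b) * w.re ^ 2)
      = (‖z‖ ^ p * u) * Real.exp (-(2 * b) * w.re ^ 2) * ‖z‖ ^ (-p) := by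
        linear_combination (-u * Real.exp (-(2 * b) * w.re ^ 2)) * hzp
    _ ≤ (2 ^ p * (1 + ‖w‖ ^ p * u)) * (Real.exp (2 * b * h ^ 2) * G) * ‖z‖ ^ (-p) := by gcongr
    _ = 2 ^ p * Real.exp (2 * b * h ^ 2) * ((1 + ‖w‖ ^ p * u) * G) * ‖z‖ ^ (-p) := by ring
    _ ≤ _ := by gcongr

/-- For `0 < κ < 4`, `a = 2/κ`, and `β > 0`, there exists `c < ∞` such that for every
`z ∈ ℍ`,
`Φ*(z) = ∫_{w ∈ ℍ, Im w < 2a} (Im w)^(8/κ-2) |w|^(2-8/κ) |z-w|^(-κ/4) |z-w̄|^(-κ/4)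
  e^(-β (Re w)²) dA(w) ≤ c |z|^(-κ/2)`. -/
theorem phi_star_bound (κ : ℝ) (hκ0 : 0 < κ) (hκ4 : κ < 4) (β : ℝ) (hβ : 0 < β) :
    ∃ c : ℝ, ∀ z : ℂ, 0 < z.im →
      (∫ w in {w : ℂ | 0 < w.im ∧ w.im < 2 * (2 / κ)},
        w.im ^ (8 / κ - 2) * ‖w‖ ^ (2 - 8 / κ) * ‖z - w‖ ^ (-(κ / 4)) *
          ‖z - (starRingEnd ℂ) w‖ ^ (-(κ / 4)) * Real.exp (-β * w.re ^ 2)) ≤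
      c * ‖z‖ ^ (-(κ / 2)) := by
  have hv : Integrable (fun w : ℂ => Real.exp (-(β / 2) * ‖w‖ ^ 2)) := by
    simpa using Complex.integrable_rpow_mul_exp_neg_mul_rpow (p := 2) (q := 0) (b := β / 2)
      (by norm_num) (by norm_num) (by positivity)
  have hu : Integrable (fun w : ℂ => ‖w‖ ^ (-(κ / 2)) * Real.exp (-‖w‖)) := by
    simpa using Complex.integrable_rpow_mul_exp_neg_mul_rpow (p := 1) (q := -(κ / 2)) (b := 1)
      le_rfl (by linarith) one_pos
  set S : Set ℂ := {w : ℂ | 0 < w.im ∧ w.im < 2 * (2 / κ)}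
  have hS : MeasurableSet S :=
    (measurableSet_lt measurable_const Complex.measurable_im).inter
      (measurableSet_lt Complex.measurable_im measurable_const)
  set A : ℝ := 2 ^ (κ / 2) * Real.exp (2 * (β / 2) * (2 * (2 / κ)) ^ 2)
  set B : ℝ := 2 + 1 / (β / 2)
  set D : ℝ := (1 + 1 / (β / 2)) * Real.exp 1
  refine ⟨A * (B * (∫ w : ℂ, Real.exp (-(β / 2) * ‖w‖ ^ 2)) +
    D * ∫ w : ℂ, ‖w‖ ^ (-(κ / 2)) * Real.exp (-‖w‖)), fun z hz => ?_⟩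
  have hu' := hu.comp_sub_left z
  have hz0 : z ≠ 0 := by rintro rfl; simp at hz
  have hint := (((hv.const_mul B).add (hu'.const_mul D)).const_mul A).mul_const (‖z‖ ^ (-(κ / 2)))
  have hexp : 0 ≤ 8 / κ - 2 := by
    rw [sub_nonneg, le_div_iff₀ hκ0]; linarith
  calc _ ≤ ∫ w in S, A * (B * Real.exp (-(β / 2) * ‖w‖ ^ 2) +
        D * (‖z - w‖ ^ (-(κ / 2)) * Real.exp (-‖z - w‖))) * ‖z‖ ^ (-(κ / 2)) := by
        refine integral_mono_of_nonneg ?_ hint.integrableOn ?_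
        · filter_upwards [ae_restrict_mem hS] with w hw
          have := hw.1.le
          simp only [Pi.zero_apply]
          positivity
        · filter_upwards [ae_restrict_mem hS] with w hw
          have him : 0 < w.im := hw.1
          have hwn : 0 < ‖w‖ := him.trans_le ((le_abs_self _).trans (Complex.abs_im_le_norm w))
          rcases eq_or_ne z w with rfl | hzw
          · have : (0 : ℝ) ^ (-(κ / 4)) = 0 := Real.zero_rpow (by linarith)
            simp only [sub_self, norm_zero, this, mul_zero, zero_mul]
            positivity
          have hx : 0 < ‖z - w‖ := norm_pos_iff.2 (sub_ne_zero.2 hzw)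
          have hratio : w.im ^ (8 / κ - 2) * ‖w‖ ^ (2 - 8 / κ) ≤ 1 := by
            rw [← neg_sub (8 / κ) 2, Real.rpow_neg hwn.le, ← div_eq_mul_inv]
            refine div_le_one_of_le₀ ?_ (by positivity)
            exact Real.rpow_le_rpow him.le ((le_abs_self _).trans (Complex.abs_im_le_norm w)) hexp
          have hconj : ‖z - (starRingEnd ℂ) w‖ ^ (-(κ / 4)) ≤ ‖z - w‖ ^ (-(κ / 4)) :=
            Real.rpow_le_rpow_of_nonpos hx
              (Complex.norm_sub_le_norm_sub_conj hz.le him.le) (by linarith)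
          have hsum : ‖z - w‖ ^ (-(κ / 4)) * ‖z - w‖ ^ (-(κ / 4)) = ‖z - w‖ ^ (-(κ / 2)) := by
            rw [← Real.rpow_add hx]; ring_nf
          have hkey := norm_sub_rpow_neg_mul_exp_le (p := κ / 2) (b := β / 2) hz0 hzw
            (by linarith) (by linarith) (by linarith) him.le hw.2.le
          rw [mul_div_cancel₀ β two_ne_zero] at hkey
          calc _ ≤ 1 * ‖z - w‖ ^ (-(κ / 4)) * ‖z - w‖ ^ (-(κ / 4)) *
                Real.exp (-β * w.re ^ 2) := by gcongr
            _ = ‖z - w‖ ^ (-(κ / 2)) * Real.exp (-β * w.re ^ 2) := by rw [one_mul, hsum]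
            _ ≤ _ := by simpa only [A, B, D, mul_div_cancel₀ β two_ne_zero] using hkey
    _ ≤ ∫ w : ℂ, A * (B * Real.exp (-(β / 2) * ‖w‖ ^ 2) +
        D * (‖z - w‖ ^ (-(κ / 2)) * Real.exp (-‖z - w‖))) * ‖z‖ ^ (-(κ / 2)) := by
        refine setIntegral_le_integral hint (Filter.Eventually.of_forall fun w => ?_)
        simp only [Pi.zero_apply]
        positivity
    _ = _ := by
        rw [integral_mul_const, integral_const_mul,
          integral_add (hv.const_mul B) (hu'.const_mul D), integral_const_mul, integral_const_mul,
          integral_sub_left_eq_self (fun w : ℂ => ‖w‖ ^ (-(κ / 2)) * Real.exp (-‖w‖)) volume z]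
end

section
/- Let 0 < κ < 4, set a = 2/κ, and let β > 0. Then there exists a constant c < ∞ such that for every s ≥ 1, ∫_ℍ ∫_ℍ 1{Im w < 2a} · (Im w)^{8/κ − 2} · |w|^{2 − 8/κ} · e^{−β (Re w)²} · (Im z)^{8/κ − 2} · |z|^{2 − 8/κ} · e^{−β |z|²/s²} · |z − w|^{−κ/4} · |z − conj(w)|^{−κ/4} dA(w) dA(z) ≤ c · s^{2 − κ/2}. -/
open MeasureTheory

open Metric in
/-- A singularity `‖x‖ ^ (-r)` of order `r < 2` is integrable near the origin of `ℂ`. -/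
theorem integrable_indicator_ball_norm_rpow_neg {r : ℝ} (hr : r < 2) :
    Integrable ((ball (0 : ℂ) 1).indicator fun u ↦ ‖u‖ ^ (-r)) := by
  rw [integrable_indicator_iff measurableSet_ball]
  refine (integrableOn_fun_norm_addHaar volume (f := fun x : ℝ ↦ x ^ (-r))).2 ?_
  rw [Complex.finrank_real_complex]
  have h : IntegrableOn (fun y : ℝ ↦ y ^ (1 - r)) (Set.Ioo 0 1) :=
    (intervalIntegral.integrableOn_Ioo_rpow_iff one_pos).2 (by linarith)
  refine h.congr_fun (fun y hy ↦ ?_) measurableSet_Ioo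
  simp [sub_eq_add_neg, Real.rpow_add hy.1]

/-- Gaussians in the norm are integrable on `ℂ`. -/
theorem integrable_exp_neg_mul_norm_sq {b : ℝ} (hb : 0 < b) :
    Integrable fun u : ℂ ↦ Real.exp (-b * ‖u‖ ^ 2) := by
  refine Integrable.of_integral_ne_zero ?_
  rw [GaussianFourier.integral_rexp_neg_mul_sq_norm hb]
  positivity

/-- Splitting a Gaussian of width `s` times a singular kernel according to whether
`‖z - w‖ < s` or not. -/
theorem exp_mul_norm_sub_rpow_neg_le {b r s : ℝ} (hb : 0 < b) (hr : 0 < r) (hs : 0 < s)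
    (z w : ℂ) :
    Real.exp (-b * ‖z‖ ^ 2 / s ^ 2) * ‖z - w‖ ^ (-r) ≤
      s ^ (-r) * ((Metric.ball (0 : ℂ) 1).indicator (fun u ↦ ‖u‖ ^ (-r)) (s⁻¹ • (z - w)) +
        Real.exp (-b * ‖s⁻¹ • z‖ ^ 2)) := by
  have hexp : Real.exp (-b * ‖s⁻¹ • z‖ ^ 2) = Real.exp (-b * ‖z‖ ^ 2 / s ^ 2) := by
    rw [norm_smul, norm_inv, Real.norm_of_nonneg hs.le]
    congr 1
    field_simp
  have hnorm : ‖s⁻¹ • (z - w)‖ = s⁻¹ * ‖z - w‖ := by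
    rw [norm_smul, norm_inv, Real.norm_of_nonneg hs.le]
  rw [hexp]
  have hle : Real.exp (-b * ‖z‖ ^ 2 / s ^ 2) ≤ 1 := by
    rw [Real.exp_le_one_iff]
    exact div_nonpos_of_nonpos_of_nonneg (by nlinarith [sq_nonneg ‖z‖]) (by positivity)
  by_cases h : ‖z - w‖ < s
  · have hmem : s⁻¹ • (z - w) ∈ Metric.ball (0 : ℂ) 1 := by
      rw [mem_ball_zero_iff, hnorm, inv_mul_lt_iff₀ hs]
      simpa using h
    rw [Set.indicator_of_mem hmem, hnorm, mul_add,
      Real.mul_rpow (by positivity) (norm_nonneg _), ← mul_assoc, ← Real.mul_rpow (by positivity)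
      (by positivity), mul_inv_cancel₀ hs.ne', Real.one_rpow, one_mul]
    have h1 : Real.exp (-b * ‖z‖ ^ 2 / s ^ 2) * ‖z - w‖ ^ (-r) ≤ ‖z - w‖ ^ (-r) :=
      mul_le_of_le_one_left (by positivity) hle
    have h2 : 0 ≤ s ^ (-r) * Real.exp (-b * ‖z‖ ^ 2 / s ^ 2) := by positivity
    linarith
  · have hmem : s⁻¹ • (z - w) ∉ Metric.ball (0 : ℂ) 1 := by
      rw [mem_ball_zero_iff, hnorm, inv_mul_lt_iff₀ hs]
      simpa using h
    rw [Set.indicator_of_notMem hmem, zero_add, mul_comm]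
    gcongr ?_ * _
    exact Real.rpow_le_rpow_of_nonpos hs (not_lt.1 h) (by linarith)

/-- Bounding an iterated Bochner integral over sets by an iterated integral of a majorant, in the
other order. -/
theorem setIntegral_setIntegral_le_of_norm_le {f F : ℂ → ℂ → ℝ} {S T : Set ℂ}
    (hS : MeasurableSet S) (hT : MeasurableSet T)
    (hfF : ∀ z ∈ S, ∀ w ∈ T, ‖f z w‖ ≤ F z w) (hF0 : ∀ z w, 0 ≤ F z w)
    (hFm : Measurable (Function.uncurry F)) (hFi : ∀ w, Integrable fun z ↦ F z w)
    (hFii : Integrable fun w ↦ ∫ z, F z w) :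
    ∫ z in S, ∫ w in T, f z w ≤ ∫ w, ∫ z, F z w := by
  have hnn : 0 ≤ ∫ w, ∫ z, F z w := integral_nonneg fun w ↦ integral_nonneg fun z ↦ hF0 z w
  rw [← ENNReal.ofReal_le_ofReal_iff hnn]
  calc ENNReal.ofReal (∫ z in S, ∫ w in T, f z w)
      ≤ ‖∫ z in S, ∫ w in T, f z w‖ₑ := Real.ofReal_le_enorm _
    _ ≤ ∫⁻ z in S, ∫⁻ w in T, ‖f z w‖ₑ :=
        (enorm_integral_le_lintegral_enorm _).trans
          (lintegral_mono fun z ↦ enorm_integral_le_lintegral_enorm _)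
    _ ≤ ∫⁻ z in S, ∫⁻ w in T, ENNReal.ofReal (F z w) := by
        refine setLIntegral_mono' hS fun z hz ↦ setLIntegral_mono' hT fun w hw ↦ ?_
        rw [← ofReal_norm]
        exact ENNReal.ofReal_le_ofReal (hfF z hz w hw)
    _ ≤ ∫⁻ z, ∫⁻ w, ENNReal.ofReal (F z w) :=
        (setLIntegral_le_lintegral _ _).trans
          (lintegral_mono fun z ↦ setLIntegral_le_lintegral _ _)
    _ = ∫⁻ w, ∫⁻ z, ENNReal.ofReal (F z w) :=
        lintegral_lintegral_swap hFm.ennreal_ofReal.aemeasurable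
    _ = ∫⁻ w, ENNReal.ofReal (∫ z, F z w) := by
        refine lintegral_congr fun w ↦ ?_
        rw [ofReal_integral_eq_lintegral_ofReal (hFi w) (.of_forall fun z ↦ hF0 z w)]
    _ = ENNReal.ofReal (∫ w, ∫ z, F z w) := by
        rw [ofReal_integral_eq_lintegral_ofReal hFii
          (.of_forall fun w ↦ integral_nonneg fun z ↦ hF0 z w)]

/-- In the upper half-plane, `(Im z) ^ p * |z| ^ (-p) ≤ 1` for `p ≥ 0`. -/
theorem im_rpow_mul_norm_rpow_neg_le_one {p : ℝ} (hp : 0 ≤ p) {z : ℂ} (hz : 0 < z.im) :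
    z.im ^ p * ‖z‖ ^ (-p) ≤ 1 := by
  have hle : z.im ≤ ‖z‖ := (le_abs_self _).trans (Complex.abs_im_le_norm z)
  have hpos : 0 < ‖z‖ := hz.trans_le hle
  rw [Real.rpow_neg hpos.le, ← div_eq_mul_inv, div_le_one (by positivity)]
  exact Real.rpow_le_rpow hz.le hle hp

/-- For `z`, `w` in the upper half-plane the reflected kernel is dominated by the direct one. -/
theorem norm_sub_rpow_neg_mul_norm_sub_conj_rpow_neg_le {q : ℝ} (hq : 0 < q) {z w : ℂ}
    (hz : 0 < z.im) (hw : 0 < w.im) :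
    ‖z - w‖ ^ (-q) * ‖z - (starRingEnd ℂ) w‖ ^ (-q) ≤ ‖z - w‖ ^ (-(2 * q)) := by
  rcases eq_or_ne z w with rfl | hne
  · rw [sub_self, norm_zero, Real.zero_rpow (by linarith), Real.zero_rpow (by linarith), zero_mul]
  have hpos : 0 < ‖z - w‖ := norm_pos_iff.2 (sub_ne_zero.2 hne)
  have hle : ‖z - w‖ ≤ ‖z - (starRingEnd ℂ) w‖ := by
    rw [← sq_le_sq₀ (norm_nonneg _) (norm_nonneg _), Complex.sq_norm, Complex.sq_norm,
      Complex.normSq_apply, Complex.normSq_apply]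
    simp only [Complex.sub_re, Complex.sub_im, Complex.conj_re, Complex.conj_im]
    nlinarith [mul_pos hz hw]
  calc ‖z - w‖ ^ (-q) * ‖z - (starRingEnd ℂ) w‖ ^ (-q)
      ≤ ‖z - w‖ ^ (-q) * ‖z - w‖ ^ (-q) := by
        gcongr ?_ * ?_
        exact Real.rpow_le_rpow_of_nonpos hpos hle (by linarith)
    _ = ‖z - w‖ ^ (-(2 * q)) := by
        rw [← Real.rpow_add hpos]
        congr 1
        ring

/-- On a horizontal strip, a Gaussian in the real part is dominated by a Gaussian in the norm. -/
theorem exp_neg_mul_re_sq_le {b m : ℝ} (hb : 0 < b) {w : ℂ} (hw : 0 < w.im) (hwm : w.im < m) :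
    Real.exp (-b * w.re ^ 2) ≤ Real.exp (b * m ^ 2) * Real.exp (-b * ‖w‖ ^ 2) := by
  rw [← Real.exp_add, Real.exp_le_exp, Complex.sq_norm, Complex.normSq_apply]
  have h : w.im ^ 2 ≤ m ^ 2 := pow_le_pow_left₀ hw.le hwm.le 2
  nlinarith [mul_le_mul_of_nonneg_left h hb.le]

/-- For `0 < κ < 4`, `a = 2/κ`, and `β > 0`, there exists `c < ∞` such that for every
`s ≥ 1`, the double integral
`∫_ℍ ∫_{w ∈ ℍ, Im w < 2a} (Im w)^(8/κ-2) |w|^(2-8/κ) e^(-β (Re w)²) ·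
  (Im z)^(8/κ-2) |z|^(2-8/κ) e^(-β |z|²/s²) · |z-w|^(-κ/4) |z-w̄|^(-κ/4) dA(w) dA(z)`
is at most `c · s^(2-κ/2)`. -/
theorem double_integral_bound (κ : ℝ) (hκ0 : 0 < κ) (hκ4 : κ < 4) (β : ℝ) (hβ : 0 < β) :
    ∃ c : ℝ, ∀ s : ℝ, 1 ≤ s →
      (∫ z in {z : ℂ | 0 < z.im},
        ∫ w in {w : ℂ | 0 < w.im ∧ w.im < 2 * (2 / κ)},
          w.im ^ (8 / κ - 2) * ‖w‖ ^ (2 - 8 / κ) * Real.exp (-β * w.re ^ 2) *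
            (z.im ^ (8 / κ - 2) * ‖z‖ ^ (2 - 8 / κ) *
              Real.exp (-β * ‖z‖ ^ 2 / s ^ 2)) *
            (‖z - w‖ ^ (-(κ / 4)) * ‖z - (starRingEnd ℂ) w‖ ^ (-(κ / 4)))) ≤
      c * s ^ (2 - κ / 2) := by
  set h : ℂ → ℝ := (Metric.ball (0 : ℂ) 1).indicator fun u ↦ ‖u‖ ^ (-(κ / 2)) with h_def
  set g : ℂ → ℝ := fun u ↦ Real.exp (-β * ‖u‖ ^ 2) with g_def
  set K : ℝ := Real.exp (β * (2 * (2 / κ)) ^ 2)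
  have hh : Integrable h := integrable_indicator_ball_norm_rpow_neg (by linarith)
  have hg : Integrable g := integrable_exp_neg_mul_norm_sq hβ
  have hh0 : ∀ u, 0 ≤ h u := fun u ↦ Set.indicator_nonneg (fun _ _ ↦ by positivity) u
  have hg0 : ∀ u, 0 ≤ g u := fun u ↦ (Real.exp_pos _).le
  have hhm : Measurable h := (by fun_prop : Measurable fun u : ℂ ↦ ‖u‖ ^ (-(κ / 2))).indicator
    measurableSet_ball
  have hgm : Measurable g := by fun_prop
  have hp : 0 ≤ 8 / κ - 2 := by
    rw [sub_nonneg, le_div_iff₀ hκ0]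
    linarith
  refine ⟨K * (∫ u, g u) * ((∫ u, h u) + ∫ u, g u), fun s hs ↦ ?_⟩
  have hs0 : 0 < s := one_pos.trans_le hs
  have hs0' : s⁻¹ ≠ 0 := inv_ne_zero hs0.ne'
  have hi1 (w : ℂ) : Integrable fun z ↦ h (s⁻¹ • (z - w)) :=
    (hh.comp_smul hs0').comp_sub_right w
  have hi2 : Integrable fun z ↦ g (s⁻¹ • z) := hg.comp_smul hs0'
  have hint (w : ℂ) :
      ∫ z, K * g w * (s ^ (-(κ / 2)) * (h (s⁻¹ • (z - w)) + g (s⁻¹ • z))) =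
        K * g w * (((∫ u, h u) + ∫ u, g u) * s ^ (2 - κ / 2)) := by
    rw [integral_const_mul, integral_const_mul, integral_add (hi1 w) hi2,
      integral_sub_right_eq_self (fun z ↦ h (s⁻¹ • z)) w,
      Measure.integral_comp_inv_smul_of_nonneg _ _ hs0.le,
      Measure.integral_comp_inv_smul_of_nonneg _ _ hs0.le, Complex.finrank_real_complex,
      sub_eq_neg_add, Real.rpow_add hs0, Real.rpow_two, smul_eq_mul, smul_eq_mul]
    ring
  have hbound := setIntegral_setIntegral_le_of_norm_le
    (f := fun z w ↦ w.im ^ (8 / κ - 2) * ‖w‖ ^ (2 - 8 / κ) * Real.exp (-β * w.re ^ 2) *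
            (z.im ^ (8 / κ - 2) * ‖z‖ ^ (2 - 8 / κ) *
              Real.exp (-β * ‖z‖ ^ 2 / s ^ 2)) *
            (‖z - w‖ ^ (-(κ / 4)) * ‖z - (starRingEnd ℂ) w‖ ^ (-(κ / 4))))
    (F := fun z w ↦ K * g w * (s ^ (-(κ / 2)) * (h (s⁻¹ • (z - w)) + g (s⁻¹ • z))))
    (S := {z : ℂ | 0 < z.im}) (T := {w : ℂ | 0 < w.im ∧ w.im < 2 * (2 / κ)})
    (measurableSet_lt measurable_const Complex.measurable_im)
    ((measurableSet_lt measurable_const Complex.measurable_im).inter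
      (measurableSet_lt Complex.measurable_im measurable_const))
    ?_ ?_ ?_ ?_ ?_
  · refine hbound.trans_eq ?_
    simp only [hint]
    rw [integral_mul_const, integral_const_mul]
    ring
  · rintro z (hz : 0 < z.im) w ⟨hw, hwm⟩
    rw [Real.norm_of_nonneg (by positivity)]
    have hz1 := im_rpow_mul_norm_rpow_neg_le_one hp hz
    have hw1 := im_rpow_mul_norm_rpow_neg_le_one hp hw
    rw [neg_sub] at hz1 hw1
    have hker := norm_sub_rpow_neg_mul_norm_sub_conj_rpow_neg_le (q := κ / 4) (by positivity) hz hw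
    rw [show 2 * (κ / 4) = κ / 2 by ring] at hker
    calc _ ≤ 1 * (K * g w) * (1 * Real.exp (-β * ‖z‖ ^ 2 / s ^ 2)) * ‖z - w‖ ^ (-(κ / 2)) := by
          gcongr
          exact exp_neg_mul_re_sq_le hβ hw hwm
      _ = K * g w * (Real.exp (-β * ‖z‖ ^ 2 / s ^ 2) * ‖z - w‖ ^ (-(κ / 2))) := by ring
      _ ≤ _ := by
          have hKg : 0 ≤ K * g w := by positivity
          exact mul_le_mul_of_nonneg_left
            (exp_mul_norm_sub_rpow_neg_le hβ (by positivity) hs0 z w) hKg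
  · intro z w
    have := hh0 (s⁻¹ • (z - w))
    positivity
  · simp only [Function.uncurry_def]
    fun_prop
  · exact fun w ↦ (((hi1 w).add hi2).const_mul _).const_mul _
  · simp only [hint]
    exact (hg.const_mul K).mul_const _
end
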